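/- arXiv:2107.11422 — 5 statements merged into one kernel-verified Lean document; each statement's English description precedes it below -/
import Mathlib

section
/- Let n ≥ 4 and 1 ≤ p ≤ n−3 be integers and set q = n−p−2. Let G be the double star T(p,q), i.e., the tree on n vertices consisting of two adjacent vertices u and v, with p further pendant vertices adjacent to u and q further pendant vertices adjacent to v. Then the characteristic polynomial of the Randić matrix of G equals X^{n−4} · (X² − 1) · (X² − pq/((p+1)(q+1))). -/
open Polynomial

open scoped Classical in
/-- The Randić matrix of a simple graph `G`: the `(u,v)` entry is `1/√(d_u d_v)` when `uv` is
an edge and `0` otherwise, where `d_v` is the degree of the vertex `v`. -/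
noncomputable def randicMatrix {V : Type*} (G : SimpleGraph V) : Matrix V V ℝ :=
  Matrix.of fun u v =>
    if G.Adj u v then
      1 / Real.sqrt (((G.neighborSet u).ncard : ℝ) * ((G.neighborSet v).ncard : ℝ))
    else 0

lemma randicMatrix_isHermitian {V : Type*} (G : SimpleGraph V) :
    (randicMatrix G).IsHermitian := by
  ext u v
  by_cases h : G.Adj u v
  · simp [randicMatrix, Matrix.conjTranspose_apply, h, h.symm, mul_comm]
  · have h' : ¬ G.Adj v u := fun hc => h hc.symm
    simp [randicMatrix, Matrix.conjTranspose_apply, h, h']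

/-- The Randić energy of a graph: the sum of the absolute values of the eigenvalues of its
Randić matrix. -/
noncomputable def randicEnergy {V : Type*} [Fintype V] [DecidableEq V] (G : SimpleGraph V) : ℝ :=
  ∑ i, |(randicMatrix_isHermitian G).eigenvalues i|

/-- The caterpillar `T(p 0, …, p (r-1))`: a path `v_0 v_1 ⋯ v_{r-1}` (the `Sum.inl` vertices)
together with, for each `i`, `p i` pendant vertices attached to `v_i` (the `Sum.inr` vertices). -/
def caterpillar (r : ℕ) (p : Fin r → ℕ) :
    SimpleGraph ((Fin r) ⊕ (Σ i : Fin r, Fin (p i))) :=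
  SimpleGraph.fromRel (fun u v =>
    (∃ i j : Fin r, u = Sum.inl i ∧ v = Sum.inl j ∧ (i : ℕ) + 1 = (j : ℕ)) ∨
    (∃ (i : Fin r) (k : Fin (p i)), u = Sum.inl i ∧ v = Sum.inr ⟨i, k⟩))

lemma caterpillar_adj_inl_inl {r : ℕ} {p : Fin r → ℕ} (i j : Fin r) :
    (caterpillar r p).Adj (Sum.inl i) (Sum.inl j) ↔
      (i : ℕ) + 1 = (j : ℕ) ∨ (j : ℕ) + 1 = (i : ℕ) := by
  simp only [caterpillar, SimpleGraph.fromRel_adj]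
  constructor
  · rintro ⟨-, (⟨a, b, ha, hb, h⟩ | ⟨a, k, -, hb⟩) | (⟨a, b, ha, hb, h⟩ | ⟨a, k, -, hb⟩)⟩ <;>
      simp_all
  · intro h
    refine ⟨fun hij => ?_, h.imp (fun h => Or.inl ⟨i, j, rfl, rfl, h⟩)
      (fun h => Or.inl ⟨j, i, rfl, rfl, h⟩)⟩
    cases hij
    omega

lemma caterpillar_adj_inl_inr {r : ℕ} {p : Fin r → ℕ} (i : Fin r) (s : Σ i : Fin r, Fin (p i)) :
    (caterpillar r p).Adj (Sum.inl i) (Sum.inr s) ↔ s.1 = i := by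
  simp only [caterpillar, SimpleGraph.fromRel_adj]
  constructor
  · rintro ⟨-, (⟨a, b, ha, hb, h⟩ | ⟨a, k, ha, hb⟩) | (⟨a, b, ha, hb, h⟩ | ⟨a, k, ha, hb⟩)⟩ <;>
      simp_all
  · rintro rfl
    exact ⟨by simp, Or.inl (Or.inr ⟨s.1, s.2, rfl, rfl⟩)⟩

lemma caterpillar_not_adj_inr_inr {r : ℕ} {p : Fin r → ℕ} (s t : Σ i : Fin r, Fin (p i)) :
    ¬ (caterpillar r p).Adj (Sum.inr s) (Sum.inr t) := by
  simp [caterpillar, SimpleGraph.fromRel_adj]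

lemma caterpillar_ncard_neighborSet_inr {r : ℕ} {p : Fin r → ℕ} (s : Σ i : Fin r, Fin (p i)) :
    ((caterpillar r p).neighborSet (Sum.inr s)).ncard = 1 := by
  rw [Set.ncard_eq_one]
  refine ⟨Sum.inl s.1, ?_⟩
  ext (j | t)
  · simp [SimpleGraph.adj_comm _ (Sum.inr s), caterpillar_adj_inl_inr, eq_comm]
  · simp [caterpillar_not_adj_inr_inr]

lemma caterpillar_two_ncard_neighborSet_inl {p : Fin 2 → ℕ} (i : Fin 2) :
    ((caterpillar 2 p).neighborSet (Sum.inl i)).ncard = p i + 1 := by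
  have h : (caterpillar 2 p).neighborSet (Sum.inl i) =
      insert (Sum.inl (1 - i)) (Set.range fun k : Fin (p i) => Sum.inr ⟨i, k⟩) := by
    ext (j | ⟨j, k⟩)
    · simp only [SimpleGraph.mem_neighborSet, caterpillar_adj_inl_inl, Set.mem_insert_iff,
        Set.mem_range, Sum.inl.injEq, reduceCtorEq, exists_false, or_false]
      fin_cases i <;> fin_cases j <;> simp
    · simp only [SimpleGraph.mem_neighborSet, caterpillar_adj_inl_inr, Set.mem_insert_iff,
        Set.mem_range, Sum.inr.injEq, reduceCtorEq, false_or]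
      constructor
      · rintro rfl
        exact ⟨k, rfl⟩
      · rintro ⟨l, hl⟩
        exact (congrArg Sigma.fst hl).symm
  have hinj : Function.Injective fun k : Fin (p i) =>
      (Sum.inr ⟨i, k⟩ : Fin 2 ⊕ Σ i : Fin 2, Fin (p i)) :=
    Sum.inr_injective.comp sigma_mk_injective
  rw [h, Set.ncard_insert_of_notMem (by simp) (Set.toFinite _), ← Set.image_univ,
    Set.ncard_image_of_injective _ hinj, Set.ncard_univ, Nat.card_eq_fintype_card,
    Fintype.card_fin]

/-- The characteristic matrix of the Randić matrix of a double star, in block form with respect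
to the two centres and the pendant vertices. -/
lemma scalar_sub_randicMatrix_caterpillar_two (p : Fin 2 → ℕ) (x : ℝ) :
    Matrix.scalar _ x - randicMatrix (caterpillar 2 p) =
      Matrix.fromBlocks
        !![x, -(√((p 0 + 1) * (p 1 + 1)))⁻¹; -(√((p 0 + 1) * (p 1 + 1)))⁻¹, x]
        (Matrix.of fun i s => if s.1 = i then -(√(p i + 1))⁻¹ else 0)
        (Matrix.of fun s i => if s.1 = i then -(√(p i + 1))⁻¹ else 0)
        (x • 1) := by
  ext (i | s) (j | t)
  · fin_cases i <;> fin_cases j <;>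
      simp [randicMatrix, caterpillar_adj_inl_inl, caterpillar_two_ncard_neighborSet_inl,
        Real.sqrt_mul (show (0 : ℝ) ≤ p 0 + 1 by positivity), mul_comm]
  · by_cases h : t.1 = i <;>
      simp [randicMatrix, caterpillar_adj_inl_inr, caterpillar_two_ncard_neighborSet_inl,
        caterpillar_ncard_neighborSet_inr, h]
  · by_cases h : s.1 = j <;>
      simp [randicMatrix, SimpleGraph.adj_comm _ (Sum.inr s), caterpillar_adj_inl_inr,
        caterpillar_two_ncard_neighborSet_inl, caterpillar_ncard_neighborSet_inr, h]
  · by_cases h : s = t <;> simp [randicMatrix, caterpillar_not_adj_inr_inr, h]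

lemma eval_charpoly_randicMatrix_caterpillar_two (p : Fin 2 → ℕ) {x : ℝ} (hx : x ≠ 0) :
    (randicMatrix (caterpillar 2 p)).charpoly.eval x * x ^ 2 =
      x ^ (p 0 + p 1) * ((x ^ 2 - 1) * (x ^ 2 - p 0 * p 1 / ((p 0 + 1) * (p 1 + 1)))) := by
  have hschur (i j : Fin 2) :
      (((Matrix.of fun i s => if s.1 = i then -(√(p i + 1))⁻¹ else 0 :
            Matrix (Fin 2) (Σ i : Fin 2, Fin (p i)) ℝ) *
          (x⁻¹ • 1 : Matrix (Σ i : Fin 2, Fin (p i)) (Σ i : Fin 2, Fin (p i)) ℝ) *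
          (Matrix.of fun s i => if s.1 = i then -(√(p i + 1))⁻¹ else 0 :
            Matrix (Σ i : Fin 2, Fin (p i)) (Fin 2) ℝ) : Matrix (Fin 2) (Fin 2) ℝ)) i j =
      if i = j then p i / ((p i + 1) * x) else 0 := by
    have hs : (√(p i + 1 : ℝ)) ^ 2 = p i + 1 := Real.sq_sqrt (by positivity)
    have hp : (√(p i + 1 : ℝ)) ≠ 0 := by positivity
    simp only [Matrix.mul_smul, Matrix.mul_one, Matrix.smul_apply,
      Matrix.mul_apply, Matrix.of_apply, Fintype.sum_sigma, smul_eq_mul]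
    split_ifs with hij
    · subst hij
      rw [Finset.sum_eq_single i (by intros; simp_all) (by simp)]
      simp only [if_true, Finset.sum_const, Finset.card_univ, Fintype.card_fin, nsmul_eq_mul]
      field_simp
      rw [hs]
    · rw [Finset.sum_eq_zero]
      intro a _
      refine Finset.sum_eq_zero fun k _ => ?_
      by_cases ha : a = i
      · simp [ha, hij]
      · simp [ha]
  let : Invertible (x • 1 : Matrix (Σ i : Fin 2, Fin (p i)) (Σ i : Fin 2, Fin (p i)) ℝ) :=
    ⟨x⁻¹ • 1, by simp [smul_smul, hx], by simp [smul_smul, hx]⟩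
  have hcinv : (√((p 0 + 1 : ℝ) * (p 1 + 1)))⁻¹ ^ 2 = ((p 0 + 1) * (p 1 + 1) : ℝ)⁻¹ := by
    rw [inv_pow, Real.sq_sqrt (by positivity)]
  rw [Matrix.eval_charpoly, scalar_sub_randicMatrix_caterpillar_two, Matrix.det_fromBlocks₂₂,
    Matrix.det_fin_two]
  simp only [Matrix.sub_apply]
  rw [show ⅟(x • 1 : Matrix (Σ i : Fin 2, Fin (p i)) (Σ i : Fin 2, Fin (p i)) ℝ) =
    x⁻¹ • 1 from rfl]
  simp only [hschur, Matrix.det_smul, Matrix.det_one, Fintype.card_sigma, Fintype.card_fin,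
    Fin.sum_univ_two, Matrix.of_apply, Matrix.cons_val', Matrix.cons_val_zero,
    Matrix.cons_val_one, Matrix.cons_val_fin_one, if_true, zero_ne_one, one_ne_zero, if_false,
    sub_zero, mul_one, neg_mul_neg]
  rw [← pow_two (√_)⁻¹, hcinv, mul_assoc]
  congr 1
  field_simp
  ring

/-- For `n ≥ 4`, `1 ≤ p ≤ n - 3` and `q = n - p - 2`, the characteristic
polynomial of the Randić matrix of the double star `T(p, q)` equals
`X^(n-4) * (X² - 1) * (X² - pq/((p+1)(q+1)))`. -/
theorem doubleStar_randic_charpoly (n p : ℕ) (hn : 4 ≤ n) (hp1 : 1 ≤ p) (hp2 : p ≤ n - 3) :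
    (randicMatrix (caterpillar 2 ![p, n - p - 2])).charpoly
      = X ^ (n - 4) * (X ^ 2 - 1) *
        (X ^ 2 - C (((p : ℝ) * ((n - p - 2 : ℕ) : ℝ)) /
            (((p : ℝ) + 1) * (((n - p - 2 : ℕ) : ℝ) + 1)))) := by
  refine Polynomial.eq_of_infinite_eval_eq _ _
    ((Set.finite_singleton (0 : ℝ)).infinite_compl.mono fun x (hx : x ≠ 0) => ?_)
  have h := eval_charpoly_randicMatrix_caterpillar_two ![p, n - p - 2] hx
  simp only [Matrix.cons_val_zero, Matrix.cons_val_one] at h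
  rw [show p + (n - p - 2) = n - 4 + 2 by omega, pow_add] at h
  refine mul_right_cancel₀ (pow_ne_zero 2 hx) (h.trans ?_)
  simp only [eval_mul, eval_sub, eval_pow, eval_X, eval_one, eval_C]
  ring
end

section
/- Let α, γ : ℝ → ℝ and let x be a real number such that α has derivative α′(x) at x, γ has derivative γ′(x) at x, γ(x) > 0, α(x) > 0, and α(x)² > γ(x). Define f(t) = √(α(t) + √(α(t)² − γ(t))) + √(α(t) − √(α(t)² − γ(t))). Then f is differentiable at x with f′(x) = (2α′(x)√(γ(x)) + γ′(x)) / (2 f(x) √(γ(x))). In particular, f′(x) ≥ 0 if and only if 2α′(x)√(γ(x)) + γ′(x) ≥ 0. -/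
/-- Denesting of the sum of the two conjugate nested radicals `√(a ± √(a² - g))`. -/
theorem sqrt_add_sqrt_add_sqrt_sub_sqrt {a g : ℝ} (ha : 0 ≤ a) (hg : 0 ≤ g) (hga : g ≤ a ^ 2) :
    Real.sqrt (a + Real.sqrt (a ^ 2 - g)) + Real.sqrt (a - Real.sqrt (a ^ 2 - g)) =
      Real.sqrt (2 * a + 2 * Real.sqrt g) := by
  have hs : Real.sqrt (a ^ 2 - g) ^ 2 = a ^ 2 - g := Real.sq_sqrt (sub_nonneg.2 hga)
  have hle : Real.sqrt (a ^ 2 - g) ≤ a := Real.sqrt_le_iff.2 ⟨ha, by linarith⟩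
  have hp : 0 ≤ a + Real.sqrt (a ^ 2 - g) := by positivity
  have hm : 0 ≤ a - Real.sqrt (a ^ 2 - g) := sub_nonneg.2 hle
  have hmul : Real.sqrt (a + Real.sqrt (a ^ 2 - g)) * Real.sqrt (a - Real.sqrt (a ^ 2 - g)) =
      Real.sqrt g := by
    rw [← Real.sqrt_mul hp]
    congr 1
    linear_combination -hs
  rw [eq_comm, Real.sqrt_eq_iff_mul_self_eq (by positivity) (by positivity)]
  linear_combination -Real.sq_sqrt hp - Real.sq_sqrt hm - 2 * hmul

/-- Suppose `α, γ : ℝ → ℝ` have derivatives `α'`, `γ'` at `x`, with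
`γ x > 0`, `α x > 0` and `(α x)² > γ x`.  Let
`f t = √(α t + √((α t)² - γ t)) + √(α t - √((α t)² - γ t))`.  Then `f` is differentiable at `x`
with `f'(x) = (2 α' √(γ x) + γ') / (2 f x √(γ x))`; in particular `f'(x) ≥ 0` iff
`2 α' √(γ x) + γ' ≥ 0`. -/
theorem derivative_of_randic_energy_aux (α γ : ℝ → ℝ) (x a' g' : ℝ)
    (hα : HasDerivAt α a' x) (hγ : HasDerivAt γ g' x)
    (hγpos : 0 < γ x) (hαpos : 0 < α x) (hdisc : γ x < (α x) ^ 2) :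
    HasDerivAt
      (fun t => Real.sqrt (α t + Real.sqrt ((α t) ^ 2 - γ t)) +
        Real.sqrt (α t - Real.sqrt ((α t) ^ 2 - γ t)))
      ((2 * a' * Real.sqrt (γ x) + g') /
        (2 * (Real.sqrt (α x + Real.sqrt ((α x) ^ 2 - γ x)) +
            Real.sqrt (α x - Real.sqrt ((α x) ^ 2 - γ x))) * Real.sqrt (γ x))) x ∧
    (0 ≤ (2 * a' * Real.sqrt (γ x) + g') /
        (2 * (Real.sqrt (α x + Real.sqrt ((α x) ^ 2 - γ x)) +
            Real.sqrt (α x - Real.sqrt ((α x) ^ 2 - γ x))) * Real.sqrt (γ x)) ↔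
      0 ≤ 2 * a' * Real.sqrt (γ x) + g') := by
  have hsum := sqrt_add_sqrt_add_sqrt_sub_sqrt hαpos.le hγpos.le hdisc.le
  have hsγ : 0 < Real.sqrt (γ x) := Real.sqrt_pos.2 hγpos
  have hf : 0 < Real.sqrt (2 * α x + 2 * Real.sqrt (γ x)) := Real.sqrt_pos.2 (by positivity)
  rw [hsum]
  refine ⟨?_, by rw [le_div_iff₀ (by positivity), zero_mul]⟩
  have hderiv := ((hα.const_mul 2).add ((hγ.sqrt hγpos.ne').const_mul 2)).sqrt
    (by simp only [Pi.add_apply]; positivity)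
  have heq : (fun t => Real.sqrt (α t + Real.sqrt ((α t) ^ 2 - γ t)) +
      Real.sqrt (α t - Real.sqrt ((α t) ^ 2 - γ t))) =ᶠ[nhds x]
      fun t => Real.sqrt (2 * α t + 2 * Real.sqrt (γ t)) := by
    filter_upwards [hα.continuousAt.eventually_const_lt hαpos,
      hγ.continuousAt.eventually_const_lt hγpos,
      hγ.continuousAt.eventually_lt (hα.continuousAt.pow 2) hdisc] with t h₁ h₂ h₃
    exact sqrt_add_sqrt_add_sqrt_sub_sqrt h₁.le h₂.le h₃.le
  refine HasDerivAt.congr_of_eventuallyEq ?_ heq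
  refine hderiv.congr_deriv ?_
  simp only [Pi.add_apply]
  field_simp
end

section
/- Let n, p, q be integers with p ≥ 1, q ≥ 1 and n ≥ p + q + 4, and let λ be a real number. Define the 3×3 real matrices A = [[0, 1/√((p+1)(n−p−q−1)), 0], [1/√((p+1)(n−p−q−1)), 0, 1/√((q+1)(n−p−q−1))], [0, 1/√((q+1)(n−p−q−1)), 0]] and B = diag(√(p/(p+1)), √((n−p−q−3)/(n−p−q−1)), √(q/(q+1))). Then η(n,p,q) · det(λ²I₃ − λ·A − B·B) = (λ² − 1) · (η(n,p,q)λ⁴ − ζ(n,p,q)λ² + χ(n,p,q)). -/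
/-- Expansion of `det (x² I₃ - x A - B * B)` for a symmetric tridiagonal `A` with zero diagonal
and a diagonal `B`. -/
theorem det_sq_smul_one_sub_smul_sub_diagonal_mul_self {R : Type*} [CommRing R]
    (x r s a b c : R) :
    Matrix.det (x ^ 2 • (1 : Matrix (Fin 3) (Fin 3) R)
        - x • Matrix.of ![![0, r, 0], ![r, 0, s], ![0, s, 0]]
        - Matrix.diagonal ![a, b, c] * Matrix.diagonal ![a, b, c]) =
      (x ^ 2 - a ^ 2) * (x ^ 2 - b ^ 2) * (x ^ 2 - c ^ 2)
        - x ^ 2 * s ^ 2 * (x ^ 2 - a ^ 2) - x ^ 2 * r ^ 2 * (x ^ 2 - c ^ 2) := by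
  simp [Matrix.det_fin_three, Matrix.diagonal_mul_diagonal]
  ring

/-- For integers `p, q ≥ 1`, `n ≥ p + q + 4` and a real `λ`, with the `3 × 3`
matrices `A` and `B` arising from the caterpillar `T(p, n-p-q-3, q)`, one has
`η(n,p,q) · det (λ² I₃ - λ A - B * B) = (λ² - 1)(η(n,p,q) λ⁴ - ζ(n,p,q) λ² + χ(n,p,q))`,
where `η = (p+1)(q+1)(n-p-q-1)`, `ζ = (n-p-q-2)(q(2p+1)+p)` and `χ = pq(n-p-q-3)`. -/
theorem caterpillar3_reduced_det (n p q : ℕ) (hp : 1 ≤ p) (hq : 1 ≤ q) (hn : p + q + 4 ≤ n)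
    (lam : ℝ) :
    (((p : ℝ) + 1) * ((q : ℝ) + 1) * ((n : ℝ) - p - q - 1)) *
      Matrix.det
        (lam ^ 2 • (1 : Matrix (Fin 3) (Fin 3) ℝ)
          - lam • (Matrix.of
              ![![0, 1 / Real.sqrt (((p : ℝ) + 1) * ((n : ℝ) - p - q - 1)), 0],
                ![1 / Real.sqrt (((p : ℝ) + 1) * ((n : ℝ) - p - q - 1)), 0,
                  1 / Real.sqrt (((q : ℝ) + 1) * ((n : ℝ) - p - q - 1))],
                ![0, 1 / Real.sqrt (((q : ℝ) + 1) * ((n : ℝ) - p - q - 1)), 0]])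
          - (Matrix.diagonal
                ![Real.sqrt ((p : ℝ) / ((p : ℝ) + 1)),
                  Real.sqrt (((n : ℝ) - p - q - 3) / ((n : ℝ) - p - q - 1)),
                  Real.sqrt ((q : ℝ) / ((q : ℝ) + 1))]) *
            (Matrix.diagonal
                ![Real.sqrt ((p : ℝ) / ((p : ℝ) + 1)),
                  Real.sqrt (((n : ℝ) - p - q - 3) / ((n : ℝ) - p - q - 1)),
                  Real.sqrt ((q : ℝ) / ((q : ℝ) + 1))]))
      = (lam ^ 2 - 1) *
          ((((p : ℝ) + 1) * ((q : ℝ) + 1) * ((n : ℝ) - p - q - 1)) * lam ^ 4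
            - (((n : ℝ) - p - q - 2) * ((q : ℝ) * (2 * (p : ℝ) + 1) + (p : ℝ))) * lam ^ 2
            + (p : ℝ) * (q : ℝ) * ((n : ℝ) - p - q - 3)) := by
  have hn' : (p : ℝ) + q + 4 ≤ n := by exact_mod_cast hn
  obtain ⟨m, hm⟩ : ∃ m : ℝ, m = (n : ℝ) - p - q - 1 := ⟨_, rfl⟩
  have hm3 : 3 ≤ m := by linarith
  have hm0 : m ≠ 0 := by linarith
  have hP : (p : ℝ) + 1 ≠ 0 := by positivity
  have hQ : (q : ℝ) + 1 ≠ 0 := by positivity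
  rw [show (n : ℝ) - p - q - 3 = m - 2 by linarith,
    show (n : ℝ) - p - q - 2 = m - 1 by linarith, ← hm]
  have hr : (1 / √(((p : ℝ) + 1) * m)) ^ 2 = 1 / (((p : ℝ) + 1) * m) := by
    rw [div_pow, one_pow, Real.sq_sqrt (by positivity)]
  have hs : (1 / √(((q : ℝ) + 1) * m)) ^ 2 = 1 / (((q : ℝ) + 1) * m) := by
    rw [div_pow, one_pow, Real.sq_sqrt (by positivity)]
  have ha : √((p : ℝ) / (p + 1)) ^ 2 = p / (p + 1) := Real.sq_sqrt (by positivity)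
  have hb : √((m - 2) / m) ^ 2 = (m - 2) / m :=
    Real.sq_sqrt (div_nonneg (by linarith) (by linarith))
  have hc : √((q : ℝ) / (q + 1)) ^ 2 = q / (q + 1) := Real.sq_sqrt (by positivity)
  rw [det_sq_smul_one_sub_smul_sub_diagonal_mul_self, hr, hs, ha, hb, hc]
  field_simp
  ring
end

section
/- Let n ≥ 7 be an integer and b ∈ {1, …, n−6}. Define, for a real variable x, α(x) = ζ(n, x, n−x−b−3)/(2η(n, x, n−x−b−3)), γ(x) = χ(n, x, n−x−b−3)/η(n, x, n−x−b−3), β(x) = √(α(x)² − γ(x)) and f(x) = √(α(x)+β(x)) + √(α(x)−β(x)). Then f is monotone nondecreasing on the real interval [1, (n−b−3)/2]; in fact, on this interval α′(x) = (b+1)(n−b−1)(n−2x−b−3)/(2(b+2)((x+1)(n−x−b−2))²) ≥ 0 and γ′(x) = b(n−b−2)(n−2x−b−3)/((b+2)(x+1)²(n−x−b−2)²) ≥ 0. -/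
/-- Denesting of the sum of the square roots of the two roots of `X ^ 2 - 2 * a * X + c`. -/
lemma sqrt_add_sqrt_sub_eq_sqrt {a c : ℝ} (ha : 0 ≤ a) (hc : 0 ≤ c) (hca : c ≤ a ^ 2) :
    √(a + √(a ^ 2 - c)) + √(a - √(a ^ 2 - c)) = √(2 * a + 2 * √c) := by
  have hle : √(a ^ 2 - c) ≤ a := Real.sqrt_le_iff.2 ⟨ha, by linarith⟩
  have hadd : 0 ≤ a + √(a ^ 2 - c) := by positivity
  have hsub : 0 ≤ a - √(a ^ 2 - c) := by linarith
  have hmul : √(a + √(a ^ 2 - c)) * √(a - √(a ^ 2 - c)) = √c := by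
    rw [← Real.sqrt_mul hadd]
    congr 1
    linear_combination -Real.sq_sqrt (sub_nonneg.2 hca)
  symm
  rw [Real.sqrt_eq_iff_mul_self_eq (by positivity) (by positivity)]
  linear_combination -Real.sq_sqrt hadd - Real.sq_sqrt hsub - 2 * hmul

/-- Let `n ≥ 7` and `b ∈ {1, …, n-6}`.  With `q x = n - x - b - 3`,
`η x = (x+1)(q x+1)(n-x-q x-1)`, `ζ x = (n-x-q x-2)(q x(2x+1)+x)`, `χ x = x·q x·(n-x-q x-3)`,
`α = ζ/(2η)`, `γ = χ/η`, `β = √(α² - γ)` and `f = √(α+β) + √(α-β)`, the function `f` is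
monotone nondecreasing on `[1, (n-b-3)/2]`; indeed on this interval
`α'(x) = (b+1)(n-b-1)(n-2x-b-3)/(2(b+2)((x+1)(n-x-b-2))²) ≥ 0` and
`γ'(x) = b(n-b-2)(n-2x-b-3)/((b+2)(x+1)²(n-x-b-2)²) ≥ 0`. -/
theorem caterpillar3_aux_monotone_middle_fixed (n b : ℕ) (hn : 7 ≤ n) (hb1 : 1 ≤ b)
    (hb2 : b ≤ n - 6) :
    let q : ℝ → ℝ := fun x => (n : ℝ) - x - b - 3
    let η : ℝ → ℝ := fun x => (x + 1) * (q x + 1) * ((n : ℝ) - x - q x - 1)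
    let ζ : ℝ → ℝ := fun x => ((n : ℝ) - x - q x - 2) * (q x * (2 * x + 1) + x)
    let χ : ℝ → ℝ := fun x => x * q x * ((n : ℝ) - x - q x - 3)
    let α : ℝ → ℝ := fun x => ζ x / (2 * η x)
    let γ : ℝ → ℝ := fun x => χ x / η x
    let β : ℝ → ℝ := fun x => Real.sqrt ((α x) ^ 2 - γ x)
    let f : ℝ → ℝ := fun x => Real.sqrt (α x + β x) + Real.sqrt (α x - β x)
    MonotoneOn f (Set.Icc (1 : ℝ) (((n : ℝ) - b - 3) / 2)) ∧
    ∀ x ∈ Set.Icc (1 : ℝ) (((n : ℝ) - b - 3) / 2),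
      (HasDerivAt α
          (((b : ℝ) + 1) * ((n : ℝ) - b - 1) * ((n : ℝ) - 2 * x - b - 3) /
            (2 * ((b : ℝ) + 2) * ((x + 1) * ((n : ℝ) - x - b - 2)) ^ 2)) x ∧
        0 ≤ ((b : ℝ) + 1) * ((n : ℝ) - b - 1) * ((n : ℝ) - 2 * x - b - 3) /
            (2 * ((b : ℝ) + 2) * ((x + 1) * ((n : ℝ) - x - b - 2)) ^ 2)) ∧
      (HasDerivAt γ
          ((b : ℝ) * ((n : ℝ) - b - 2) * ((n : ℝ) - 2 * x - b - 3) /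
            (((b : ℝ) + 2) * (x + 1) ^ 2 * ((n : ℝ) - x - b - 2) ^ 2)) x ∧
        0 ≤ (b : ℝ) * ((n : ℝ) - b - 2) * ((n : ℝ) - 2 * x - b - 3) /
            (((b : ℝ) + 2) * (x + 1) ^ 2 * ((n : ℝ) - x - b - 2) ^ 2)) := by
  intro q η ζ χ α γ β f
  have hb : (1 : ℝ) ≤ b := by exact_mod_cast hb1
  have hbn : (b : ℝ) + 6 ≤ n := by exact_mod_cast (by omega : b + 6 ≤ n)
  have hq {x : ℝ} (hx : x ∈ Set.Icc (1 : ℝ) (((n : ℝ) - b - 3) / 2)) : x ≤ q x := by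
    have := hx.2
    simp only [q]
    linarith
  have hηq (x : ℝ) : η x = (x + 1) * (q x + 1) * (b + 2) := by simp only [η, q]; ring
  have hζq (x : ℝ) : ζ x = (b + 1) * (q x * (2 * x + 1) + x) := by simp only [ζ, q]; ring
  have hχq (x : ℝ) : χ x = x * q x * b := by simp only [χ, q]; ring
  have hη {x : ℝ} (hx : x ∈ Set.Icc (1 : ℝ) (((n : ℝ) - b - 3) / 2)) : 0 < η x := by
    have := hx.1
    have := hq hx
    rw [hηq]
    exact mul_pos (mul_pos (by linarith) (by linarith)) (by linarith)
  have hq' (x : ℝ) : HasDerivAt q (-1) x := by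
    simpa [q] using (((hasDerivAt_id x).const_sub (n : ℝ)).sub_const (b : ℝ)).sub_const 3
  have hη' (x : ℝ) : HasDerivAt η ((q x - x) * (b + 2)) x := by
    rw [funext hηq]
    refine ((((hasDerivAt_id x).add_const 1).mul ((hq' x).add_const 1)).mul_const
      ((b : ℝ) + 2)).congr_deriv ?_
    simp only [id]
    ring
  have hζ' (x : ℝ) : HasDerivAt ζ ((b + 1) * (2 * (q x - x))) x := by
    rw [funext hζq]
    refine ((((hq' x).mul (((hasDerivAt_id x).const_mul 2).add_const 1)).add
      (hasDerivAt_id x)).const_mul ((b : ℝ) + 1)).congr_deriv ?_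
    simp only [id]
    ring
  have hχ' (x : ℝ) : HasDerivAt χ ((q x - x) * b) x := by
    rw [funext hχq]
    refine (((hasDerivAt_id x).mul (hq' x)).mul_const (b : ℝ)).congr_deriv ?_
    simp only [id]
    ring
  have hderiv : ∀ x ∈ Set.Icc (1 : ℝ) (((n : ℝ) - b - 3) / 2),
      (HasDerivAt α
          (((b : ℝ) + 1) * ((n : ℝ) - b - 1) * ((n : ℝ) - 2 * x - b - 3) /
            (2 * ((b : ℝ) + 2) * ((x + 1) * ((n : ℝ) - x - b - 2)) ^ 2)) x ∧
        0 ≤ ((b : ℝ) + 1) * ((n : ℝ) - b - 1) * ((n : ℝ) - 2 * x - b - 3) /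
            (2 * ((b : ℝ) + 2) * ((x + 1) * ((n : ℝ) - x - b - 2)) ^ 2)) ∧
      (HasDerivAt γ
          ((b : ℝ) * ((n : ℝ) - b - 2) * ((n : ℝ) - 2 * x - b - 3) /
            (((b : ℝ) + 2) * (x + 1) ^ 2 * ((n : ℝ) - x - b - 2) ^ 2)) x ∧
        0 ≤ (b : ℝ) * ((n : ℝ) - b - 2) * ((n : ℝ) - 2 * x - b - 3) /
            (((b : ℝ) + 2) * (x + 1) ^ 2 * ((n : ℝ) - x - b - 2) ^ 2)) := by
    intro x hx
    have hx1 := hx.1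
    have hxq := hq hx
    have hηx := (hη hx).ne'
    have hx0 : x + 1 ≠ 0 := by linarith
    have hb0 : (b : ℝ) + 2 ≠ 0 := by linarith
    have hq0 : q x + 1 ≠ 0 := by linarith
    have hn1 : (n : ℝ) - b - 1 = x + q x + 2 := by simp only [q]; ring
    have hn2 : (n : ℝ) - b - 2 = x + q x + 1 := by simp only [q]; ring
    have hnx : (n : ℝ) - 2 * x - b - 3 = q x - x := by simp only [q]; ring
    have hnq : (n : ℝ) - x - b - 2 = q x + 1 := by simp only [q]; ring
    rw [hn1, hn2, hnx, hnq]
    have hsub : 0 ≤ q x - x := by linarith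
    have hq_nonneg : 0 ≤ q x := by linarith
    refine ⟨⟨?_, by positivity⟩, ?_, by positivity⟩
    · refine ((hζ' x).div ((hη' x).const_mul 2) (by positivity)).congr_deriv ?_
      rw [hηq, hζq]
      field_simp
      ring
    · refine ((hχ' x).div (hη' x) hηx).congr_deriv ?_
      rw [hηq, hχq]
      field_simp
      ring
  have hα : MonotoneOn α (Set.Icc (1 : ℝ) (((n : ℝ) - b - 3) / 2)) :=
    monotoneOn_of_hasDerivWithinAt_nonneg (convex_Icc _ _)
      (fun x hx => (hderiv x hx).1.1.continuousAt.continuousWithinAt)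
      (fun x hx => (hderiv x (interior_subset hx)).1.1.hasDerivWithinAt)
      (fun x hx => (hderiv x (interior_subset hx)).1.2)
  have hγ : MonotoneOn γ (Set.Icc (1 : ℝ) (((n : ℝ) - b - 3) / 2)) :=
    monotoneOn_of_hasDerivWithinAt_nonneg (convex_Icc _ _)
      (fun x hx => (hderiv x hx).2.1.continuousAt.continuousWithinAt)
      (fun x hx => (hderiv x (interior_subset hx)).2.1.hasDerivWithinAt)
      (fun x hx => (hderiv x (interior_subset hx)).2.2)
  have hf : ∀ x ∈ Set.Icc (1 : ℝ) (((n : ℝ) - b - 3) / 2), f x = √(2 * α x + 2 * √(γ x)) := by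
    intro x hx
    have hx0 : 0 ≤ x := zero_le_one.trans hx.1
    have hq0 : 0 ≤ q x := hx0.trans (hq hx)
    have hηx := hη hx
    have hζ0 : 0 ≤ ζ x := by rw [hζq]; positivity
    have hχ0 : 0 ≤ χ x := by rw [hχq]; positivity
    refine sqrt_add_sqrt_sub_eq_sqrt (by positivity) (by positivity) ?_
    have hdisc : 4 * χ x * η x ≤ ζ x ^ 2 := by
      have : 0 ≤ (b : ℝ) * (b + 2) * (x - q x) ^ 2 + (q x * (2 * x + 1) + x) ^ 2 := by positivity
      rw [hζq, hχq, hηq]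
      linear_combination this
    simp only [α, γ]
    rw [div_pow, div_le_div_iff₀ hηx (by positivity)]
    linear_combination η x * hdisc
  refine ⟨fun x hx y hy hxy => ?_, hderiv⟩
  rw [hf x hx, hf y hy]
  have := hα hx hy hxy
  have := hγ hx hy hxy
  gcongr
end

section
/- Let n ≥ 7 be an integer. Define, for a real variable x, α(x) = ζ(n,x,x)/(2η(n,x,x)), γ(x) = χ(n,x,x)/η(n,x,x), β(x) = √(α(x)² − γ(x)) and f(x) = √(α(x)+β(x)) + √(α(x)−β(x)). Set r₁ = (2n − 3 − √(2n(n−2)+3))/2 and s₁ = (2(n−1) − √(2n(n−1)))/2. Then f is monotone nondecreasing on the real interval [1, r₁] and monotone nonincreasing on the real interval [s₁, (n−4)/2]. -/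
/-- The derivative of `√(x/(x+1)) (1 + √(1 - 2/(c-2x-1)))`. -/
theorem hasDerivAt_sqrt_mul_one_add_sqrt {c x : ℝ} (hx : 0 < x) (hm : 3 ≤ c - 2 * x - 1) :
    HasDerivAt
      (fun x : ℝ => Real.sqrt (x / (x + 1)) * (1 + Real.sqrt (1 - 2 / (c - 2 * x - 1))))
      (((Real.sqrt (1 - 2 / (c - 2 * x - 1)) + (1 - 2 / (c - 2 * x - 1))) * (c - 2 * x - 1) ^ 2
          - 4 * x * (x + 1)) /
        (2 * Real.sqrt (x / (x + 1)) * Real.sqrt (1 - 2 / (c - 2 * x - 1)) *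
          ((x + 1) ^ 2 * (c - 2 * x - 1) ^ 2))) x := by
  have hm0 : c - 2 * x - 1 ≠ 0 := by linarith
  have hx1 : x + 1 ≠ 0 := by linarith
  have ht : 0 < x / (x + 1) := by positivity
  have hu : 0 < 1 - 2 / (c - 2 * x - 1) := by
    rw [sub_pos, div_lt_one (by linarith)]
    linarith
  have hdt : HasDerivAt (fun x : ℝ => x / (x + 1)) ((1 * (x + 1) - x * 1) / (x + 1) ^ 2) x :=
    (hasDerivAt_id' x).fun_div ((hasDerivAt_id' x).add_const 1) hx1
  have hdm : HasDerivAt (fun x : ℝ => c - 2 * x - 1) (-(2 * 1)) x :=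
    (((hasDerivAt_id' x).const_mul 2).const_sub c).sub_const 1
  have hdu : HasDerivAt (fun x : ℝ => 1 - 2 / (c - 2 * x - 1))
      (-((0 * (c - 2 * x - 1) - 2 * (-(2 * 1))) / (c - 2 * x - 1) ^ 2)) x :=
    ((hasDerivAt_const x (2 : ℝ)).fun_div hdm hm0).const_sub 1
  refine ((hdt.sqrt ht.ne').fun_mul ((hdu.sqrt hu.ne').const_add 1)).congr_deriv ?_
  have hst := Real.sqrt_pos.2 ht
  have hsu := Real.sqrt_pos.2 hu
  have hst2 : Real.sqrt (x / (x + 1)) ^ 2 = x / (x + 1) := Real.sq_sqrt ht.le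
  have hsu2 : Real.sqrt (1 - 2 / (c - 2 * x - 1)) ^ 2 = 1 - 2 / (c - 2 * x - 1) :=
    Real.sq_sqrt hu.le
  generalize Real.sqrt (1 - 2 / (c - 2 * x - 1)) = s at *
  rw [← hsu2]
  generalize Real.sqrt (x / (x + 1)) = r at *
  generalize c - 2 * x - 1 = m at *
  rw [eq_div_iff hx1] at hst2
  field_simp
  linear_combination (-4 * (x + 1)) * hst2

theorem monotoneOn_sqrt_mul_one_add_sqrt {c : ℝ} {s : Set ℝ} (hs : Convex ℝ s)
    (hpos : ∀ x ∈ s, 0 < x) (hm : ∀ x ∈ s, 3 ≤ c - 2 * x - 1)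
    (h : ∀ x ∈ s, 2 * x * (x + 1) ≤ (c - 2 * x - 1) * (c - 2 * x - 3)) :
    MonotoneOn
      (fun x : ℝ => Real.sqrt (x / (x + 1)) * (1 + Real.sqrt (1 - 2 / (c - 2 * x - 1)))) s := by
  have hd := fun x hx => hasDerivAt_sqrt_mul_one_add_sqrt (hpos x hx) (hm x hx)
  refine monotoneOn_of_hasDerivWithinAt_nonneg hs
    (fun x hx => (hd x hx).continuousAt.continuousWithinAt)
    (fun x hx => (hd x (interior_subset hx)).hasDerivWithinAt) fun x hx => ?_
  replace hx := interior_subset hx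
  have hm := hm x hx
  have h := h x hx
  have hx := hpos x hx
  refine div_nonneg ?_ (by positivity)
  have hu : (1 - 2 / (c - 2 * x - 1)) * (c - 2 * x - 1) ^ 2
      = (c - 2 * x - 1) * (c - 2 * x - 3) := by
    field_simp [show c - 2 * x - 1 ≠ 0 by linarith]
    ring
  have hle : 1 - 2 / (c - 2 * x - 1) ≤ Real.sqrt (1 - 2 / (c - 2 * x - 1)) := by
    have hp : 0 ≤ 2 / (c - 2 * x - 1) := div_nonneg zero_le_two (by linarith)
    have hp1 : 2 / (c - 2 * x - 1) ≤ 1 := (div_le_one (by linarith)).2 (by linarith)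
    apply Real.le_sqrt_of_sq_le
    nlinarith
  have := mul_le_mul_of_nonneg_right hle (sq_nonneg (c - 2 * x - 1))
  linarith

theorem antitoneOn_sqrt_mul_one_add_sqrt {c : ℝ} {s : Set ℝ} (hs : Convex ℝ s)
    (hpos : ∀ x ∈ s, 0 < x) (hm : ∀ x ∈ s, 3 ≤ c - 2 * x - 1)
    (h : ∀ x ∈ s, (c - 2 * x - 1) * (c - 2 * x - 2) ≤ 2 * x * (x + 1)) :
    AntitoneOn
      (fun x : ℝ => Real.sqrt (x / (x + 1)) * (1 + Real.sqrt (1 - 2 / (c - 2 * x - 1)))) s := by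
  have hd := fun x hx => hasDerivAt_sqrt_mul_one_add_sqrt (hpos x hx) (hm x hx)
  refine antitoneOn_of_hasDerivWithinAt_nonpos hs
    (fun x hx => (hd x hx).continuousAt.continuousWithinAt)
    (fun x hx => (hd x (interior_subset hx)).hasDerivWithinAt) fun x hx => ?_
  replace hx := interior_subset hx
  have hm := hm x hx
  have h := h x hx
  have hx := hpos x hx
  refine div_nonpos_of_nonpos_of_nonneg ?_ (by positivity)
  have hu : (1 - 2 / (c - 2 * x - 1)) * (c - 2 * x - 1) ^ 2
      = (c - 2 * x - 1) * (c - 2 * x - 3) := by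
    field_simp [show c - 2 * x - 1 ≠ 0 by linarith]
    ring
  have hu' : (1 - 1 / (c - 2 * x - 1)) * (c - 2 * x - 1) ^ 2
      = (c - 2 * x - 1) * (c - 2 * x - 2) := by
    field_simp [show c - 2 * x - 1 ≠ 0 by linarith]
    ring
  have hle : Real.sqrt (1 - 2 / (c - 2 * x - 1)) ≤ 1 - 1 / (c - 2 * x - 1) := by
    have hp1 : 1 / (c - 2 * x - 1) ≤ 1 := (div_le_one (by linarith)).2 (by linarith)
    have h2 : 2 / (c - 2 * x - 1) = 2 * (1 / (c - 2 * x - 1)) := by ring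
    rw [h2]
    apply Real.sqrt_le_iff.2 ⟨by linarith, ?_⟩
    nlinarith [sq_nonneg (1 / (c - 2 * x - 1))]
  have := mul_le_mul_of_nonneg_right hle (sq_nonneg (c - 2 * x - 1))
  linarith

/-- Closed form of `√(α+β) + √(α-β)`: here `α² - γ` is the square of `x / ((x+1)(c-2x-1))`. -/
theorem sqrt_add_sqrt_eq_sqrt_mul_one_add_sqrt {c x a b : ℝ} (hx : 0 < x)
    (hm : 3 ≤ c - 2 * x - 1)
    (ha : a = (c - 2 * x - 2) * (2 * x ^ 2 + 2 * x) / (2 * ((x + 1) ^ 2 * (c - 2 * x - 1))))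
    (hb : b = Real.sqrt (a ^ 2 - x ^ 2 * (c - 2 * x - 3) / ((x + 1) ^ 2 * (c - 2 * x - 1)))) :
    Real.sqrt (a + b) + Real.sqrt (a - b) =
      Real.sqrt (x / (x + 1)) * (1 + Real.sqrt (1 - 2 / (c - 2 * x - 1))) := by
  have hm0 : 0 < c - 2 * x - 1 := by linarith
  have hbeta : b = x / ((x + 1) * (c - 2 * x - 1)) := by
    rw [hb, ha, ← Real.sqrt_sq (show 0 ≤ x / ((x + 1) * (c - 2 * x - 1)) by positivity)]
    congr 1
    field_simp
    ring
  have hplus : a + b = x / (x + 1) := by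
    rw [ha, hbeta]
    field_simp
    ring
  have hminus : a - b = x / (x + 1) * (1 - 2 / (c - 2 * x - 1)) := by
    rw [ha, hbeta]
    field_simp
    ring
  rw [hplus, hminus, Real.sqrt_mul (by positivity)]
  ring

/-- Let `n ≥ 7`.  With `η x = (x+1)²(n-2x-1)`, `ζ x = (n-2x-2)(2x²+2x)`,
`χ x = x²(n-2x-3)`, `α = ζ/(2η)`, `γ = χ/η`, `β = √(α² - γ)` and `f = √(α+β) + √(α-β)`, and with
`r₁ = (2n - 3 - √(2n(n-2)+3))/2`, `s₁ = (2(n-1) - √(2n(n-1)))/2`, the function `f` is monotone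
nondecreasing on `[1, r₁]` and monotone nonincreasing on `[s₁, (n-4)/2]`. -/
theorem caterpillar3_aux_monotone_symmetric (n : ℕ) (hn : 7 ≤ n) :
    let η : ℝ → ℝ := fun x => (x + 1) ^ 2 * ((n : ℝ) - 2 * x - 1)
    let ζ : ℝ → ℝ := fun x => ((n : ℝ) - 2 * x - 2) * (2 * x ^ 2 + 2 * x)
    let χ : ℝ → ℝ := fun x => x ^ 2 * ((n : ℝ) - 2 * x - 3)
    let α : ℝ → ℝ := fun x => ζ x / (2 * η x)
    let γ : ℝ → ℝ := fun x => χ x / η x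
    let β : ℝ → ℝ := fun x => Real.sqrt ((α x) ^ 2 - γ x)
    let f : ℝ → ℝ := fun x => Real.sqrt (α x + β x) + Real.sqrt (α x - β x)
    MonotoneOn f
        (Set.Icc (1 : ℝ) ((2 * (n : ℝ) - 3 - Real.sqrt (2 * (n : ℝ) * ((n : ℝ) - 2) + 3)) / 2)) ∧
    AntitoneOn f
        (Set.Icc ((2 * ((n : ℝ) - 1) - Real.sqrt (2 * (n : ℝ) * ((n : ℝ) - 1))) / 2)
          (((n : ℝ) - 4) / 2)) := by
  have hc : (7 : ℝ) ≤ n := by exact_mod_cast hn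
  generalize (n : ℝ) = c at *
  intro η ζ χ α γ β f
  have hf : ∀ x, 0 < x → 3 ≤ c - 2 * x - 1 →
      Real.sqrt (x / (x + 1)) * (1 + Real.sqrt (1 - 2 / (c - 2 * x - 1))) = f x :=
    fun x hx hm => (sqrt_add_sqrt_eq_sqrt_mul_one_add_sqrt hx hm rfl rfl).symm
  constructor
  · have hpos : ∀ x ∈ Set.Icc (1 : ℝ) ((2 * c - 3 - Real.sqrt (2 * c * (c - 2) + 3)) / 2),
        0 < x := fun x hx => by linarith [hx.1]
    have hm : ∀ x ∈ Set.Icc (1 : ℝ) ((2 * c - 3 - Real.sqrt (2 * c * (c - 2) + 3)) / 2),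
        3 ≤ c - 2 * x - 1 := fun x hx => by
      have : c + 1 ≤ Real.sqrt (2 * c * (c - 2) + 3) := Real.le_sqrt_of_sq_le (by nlinarith)
      linarith [hx.2]
    refine (monotoneOn_sqrt_mul_one_add_sqrt (convex_Icc _ _) hpos hm fun x hx => ?_).congr
      fun x hx => hf x (hpos x hx) (hm x hx)
    have hle : Real.sqrt (2 * c * (c - 2) + 3) ≤ 2 * c - 3 - 2 * x := by linarith [hx.2]
    have := (Real.sqrt_le_iff.1 hle).2
    nlinarith
  · have hpos : ∀ x ∈ Set.Icc ((2 * (c - 1) - Real.sqrt (2 * c * (c - 1))) / 2) ((c - 4) / 2),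
        0 < x := fun x hx => by
      have : Real.sqrt (2 * c * (c - 1)) < 2 * (c - 1) :=
        (Real.sqrt_lt' (by linarith)).2 (by nlinarith)
      linarith [hx.1]
    have hm : ∀ x ∈ Set.Icc ((2 * (c - 1) - Real.sqrt (2 * c * (c - 1))) / 2) ((c - 4) / 2),
        3 ≤ c - 2 * x - 1 := fun x hx => by linarith [hx.2]
    refine (antitoneOn_sqrt_mul_one_add_sqrt (convex_Icc _ _) hpos hm fun x hx => ?_).congr
      fun x hx => hf x (hpos x hx) (hm x hx)
    have hle : 2 * (c - 1) - 2 * x ≤ Real.sqrt (2 * c * (c - 1)) := by linarith [hx.1]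
    have := (Real.le_sqrt (by linarith [hx.2]) (by nlinarith)).1 hle
    nlinarith
end
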